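/- arXiv:1209.4315 — 4 statements merged into one kernel-verified Lean document; each statement's English description precedes it below -/
import Mathlib

section
/- If H, K are unbiased real Hadamard matrices of order n, then H Kᵀ = √n · A, where A is a Hadamard matrix of order n. -/
/-- A real Hadamard matrix of order `m`: entries in `{1, -1}` and
`H * Hᵀ = m • I`. -/
def IsHadamardR (m : ℕ) (H : Matrix (Fin m) (Fin m) ℝ) : Prop :=
  (∀ i j, H i j = 1 ∨ H i j = -1) ∧
  H * H.transpose = (m : ℝ) • (1 : Matrix (Fin m) (Fin m) ℝ)

theorem unbiased_pair_eq_sqrt_smul_hadamard (n : ℕ)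
    (H K : Matrix (Fin n) (Fin n) ℝ)
    (hH : IsHadamardR n H) (hK : IsHadamardR n K)
    (hub : ∀ i j, |(H * K.transpose) i j| = Real.sqrt n) :
    ∃ A : Matrix (Fin n) (Fin n) ℝ,
      IsHadamardR n A ∧ H * K.transpose = Real.sqrt n • A := by
  rcases Nat.eq_zero_or_pos n with h0 | hn
  · subst h0
    exact ⟨1, ⟨fun i => i.elim0, Subsingleton.elim _ _⟩, Subsingleton.elim _ _⟩
  have hn' : (0 : ℝ) < n := by exact_mod_cast hn
  have hs : 0 < Real.sqrt n := Real.sqrt_pos.mpr hn'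
  have hss : Real.sqrt n * Real.sqrt n = n := Real.mul_self_sqrt hn'.le
  have hKK : K.transpose * K = (n : ℝ) • (1 : Matrix (Fin n) (Fin n) ℝ) := by
    have h1 : K * ((n : ℝ)⁻¹ • K.transpose) = 1 := by
      rw [Matrix.mul_smul, hK.2, smul_smul, inv_mul_cancel₀ hn'.ne', one_smul]
    have h2 := mul_eq_one_comm.mp h1
    rw [Matrix.smul_mul] at h2
    rw [← h2, smul_smul, mul_inv_cancel₀ hn'.ne', one_smul]
  have hprod : (H * K.transpose) * (H * K.transpose).transpose
      = ((n : ℝ) * n) • (1 : Matrix (Fin n) (Fin n) ℝ) := by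
    rw [Matrix.transpose_mul, Matrix.transpose_transpose, Matrix.mul_assoc,
      ← Matrix.mul_assoc K.transpose, hKK, Matrix.smul_mul, Matrix.one_mul,
      Matrix.mul_smul, hH.2, smul_smul]
  refine ⟨(Real.sqrt n)⁻¹ • (H * K.transpose), ⟨fun i j => ?_, ?_⟩, ?_⟩
  · rw [Matrix.smul_apply, smul_eq_mul]
    rcases (abs_eq hs.le).mp (hub i j) with h | h
    · left
      rw [h, inv_mul_cancel₀ hs.ne']
    · right
      rw [h, mul_neg, inv_mul_cancel₀ hs.ne']
  · rw [Matrix.transpose_smul, Matrix.smul_mul, Matrix.mul_smul, hprod, smul_smul, smul_smul,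
      ← mul_assoc, ← mul_inv, hss, inv_mul_cancel₀ hn'.ne', one_mul]
  · rw [smul_smul, mul_inv_cancel₀ hs.ne', one_smul]
end

section
/- There exists a pair of weakly unbiased real Hadamard matrices of order 12 that is not modularly homogeneous, i.e., Hadamard matrices H, K of order 12 such that H and K are weakly unbiased but some entry of HJ + JKᵀ is not divisible by 4 (J the all-ones matrix of order 12). -/
/-- A real Hadamard matrix of order `m` (with integer entries):
entries in `{1, -1}` and `H * Hᵀ = m • I`. -/
def IsHadamard (m : ℕ) (H : Matrix (Fin m) (Fin m) ℤ) : Prop :=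
  (∀ i j, H i j = 1 ∨ H i j = -1) ∧
  H * H.transpose = (m : ℤ) • (1 : Matrix (Fin m) (Fin m) ℤ)

/-- The all-ones matrix of order `m`. -/
def allOnes (m : ℕ) : Matrix (Fin m) (Fin m) ℤ := Matrix.of fun _ _ => 1

/-- `H` and `K` are modularly homogeneous if every entry of `HJ + JKᵀ` is
divisible by 4, `J` the all-ones matrix. -/
def ModHomogeneous (m : ℕ) (H K : Matrix (Fin m) (Fin m) ℤ) : Prop :=
  ∀ i j, (4 : ℤ) ∣ (H * allOnes m + allOnes m * K.transpose) i j

/-- `H` and `K` are weakly unbiased if the set of absolute values of the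
entries of `H * Kᵀ` has at most two elements and every entry of `H * Kᵀ`
is congruent to 2 modulo 4. -/
def WeaklyUnbiased (m : ℕ) (H K : Matrix (Fin m) (Fin m) ℤ) : Prop :=
  {x : ℤ | ∃ i j, |(H * K.transpose) i j| = x}.ncard ≤ 2 ∧
  ∀ i j, (H * K.transpose) i j % 4 = 2

/-- Skew Paley Hadamard matrix `I + S` of order 12. -/
def skewH : Matrix (Fin 12) (Fin 12) ℤ :=
  !![1, 1, 1, 1, 1, 1, 1, 1, 1, 1, 1, 1;
     -1, 1, 1, -1, 1, 1, 1, -1, -1, -1, 1, -1;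
     -1, -1, 1, 1, -1, 1, 1, 1, -1, -1, -1, 1;
     -1, 1, -1, 1, 1, -1, 1, 1, 1, -1, -1, -1;
     -1, -1, 1, -1, 1, 1, -1, 1, 1, 1, -1, -1;
     -1, -1, -1, 1, -1, 1, 1, -1, 1, 1, 1, -1;
     -1, -1, -1, -1, 1, -1, 1, 1, -1, 1, 1, 1;
     -1, 1, -1, -1, -1, 1, -1, 1, 1, -1, 1, 1;
     -1, 1, 1, -1, -1, -1, 1, -1, 1, 1, -1, 1;
     -1, 1, 1, 1, -1, -1, -1, 1, -1, 1, 1, -1;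
     -1, -1, 1, 1, 1, -1, -1, -1, 1, -1, 1, 1;
     -1, 1, -1, 1, 1, 1, -1, -1, -1, 1, -1, 1]

/-- The matrix `S - I`. -/
def skewK : Matrix (Fin 12) (Fin 12) ℤ :=
  !![-1, 1, 1, 1, 1, 1, 1, 1, 1, 1, 1, 1;
     -1, -1, 1, -1, 1, 1, 1, -1, -1, -1, 1, -1;
     -1, -1, -1, 1, -1, 1, 1, 1, -1, -1, -1, 1;
     -1, 1, -1, -1, 1, -1, 1, 1, 1, -1, -1, -1;
     -1, -1, 1, -1, -1, 1, -1, 1, 1, 1, -1, -1;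
     -1, -1, -1, 1, -1, -1, 1, -1, 1, 1, 1, -1;
     -1, -1, -1, -1, 1, -1, -1, 1, -1, 1, 1, 1;
     -1, 1, -1, -1, -1, 1, -1, -1, 1, -1, 1, 1;
     -1, 1, 1, -1, -1, -1, 1, -1, -1, 1, -1, 1;
     -1, 1, 1, 1, -1, -1, -1, 1, -1, -1, 1, -1;
     -1, -1, 1, 1, 1, -1, -1, -1, 1, -1, -1, 1;
     -1, 1, -1, 1, 1, 1, -1, -1, -1, 1, -1, -1]

theorem skewH_entries : ∀ i j, skewH i j = (1 : ℤ) ∨ skewH i j = (-1 : ℤ) := by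
  have h : ∀ i j, |skewH i j| = (1 : ℤ) := by decide +kernel
  exact fun i j => (abs_eq zero_le_one).mp (h i j)

theorem skewK_entries : ∀ i j, skewK i j = (1 : ℤ) ∨ skewK i j = (-1 : ℤ) := by
  have h : ∀ i j, |skewK i j| = (1 : ℤ) := by decide +kernel
  exact fun i j => (abs_eq zero_le_one).mp (h i j)

theorem skew_abs : ∀ i j, |(skewH * skewK.transpose) i j| = 2 ∨
    |(skewH * skewK.transpose) i j| = 10 := by decide +kernel

theorem exists_weaklyUnbiased_not_modHomogeneous_order_12 :
    ∃ H K : Matrix (Fin 12) (Fin 12) ℤ,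
      IsHadamard 12 H ∧ IsHadamard 12 K ∧
      WeaklyUnbiased 12 H K ∧ ¬ ModHomogeneous 12 H K := by
  refine ⟨skewH, skewK, ⟨skewH_entries, by decide +kernel⟩,
    ⟨skewK_entries, by decide +kernel⟩, ⟨?_, by decide +kernel⟩, ?_⟩
  · have hsub : {x : ℤ | ∃ i j, |(skewH * skewK.transpose) i j| = x} ⊆ {2, 10} := by
      rintro x ⟨i, j, rfl⟩
      exact skew_abs i j
    exact (Set.ncard_le_ncard hsub (Set.toFinite _)).trans (by rw [Set.ncard_pair (by norm_num)])
  · intro h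
    have h0 : ¬ (4 : ℤ) ∣ (skewH * allOnes 12 + allOnes 12 * skewK.transpose) 0 0 := by
      decide +kernel
    exact h0 (h 0 0)
end

section
/- For any odd positive integer n, every set of real Hadamard matrices of order 4n that are pairwise weakly unbiased has at most 2 elements. -/
/-- Any set of pairwise weakly unbiased Hadamard matrices of order `4n`,
`n` odd, has at most 2 elements. -/
theorem weaklyUnbiased_family_le_two (n : ℕ) (hn : Odd n)
    (S : Set (Matrix (Fin (4 * n)) (Fin (4 * n)) ℤ))
    (hHad : ∀ H ∈ S, IsHadamard (4 * n) H)
    (hub : ∀ H ∈ S, ∀ K ∈ S, H ≠ K → WeaklyUnbiased (4 * n) H K) :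
    ∃ A B, S ⊆ {A, B} := by
  by_contra hcon
  have key : ∀ A B, ∃ X ∈ S, X ≠ A ∧ X ≠ B := by
    intro A B
    by_contra h
    refine hcon ⟨A, B, fun X hX => ?_⟩
    by_contra hX'
    refine h ⟨X, hX, fun e => hX' (by simp [e]), fun e => hX' (by simp [e])⟩
  obtain ⟨X, hX, -, -⟩ := key 0 0
  obtain ⟨Y, hY, hYX, -⟩ := key X X
  obtain ⟨Z, hZ, hZX, hZY⟩ := key X Y
  have hpos : 0 < 4 * n := by
    have := hn.pos
    omega
  let i : Fin (4 * n) := ⟨0, hpos⟩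
  have h1 := (hub X hX Y hY hYX.symm).2 i i
  have h2 := (hub X hX Z hZ hZX.symm).2 i i
  have h3 := (hub Y hY Z hZ hZY.symm).2 i i
  simp only [Matrix.mul_apply, Matrix.transpose_apply] at h1 h2 h3
  have hd : (4 : ℤ) ∣ ∑ j : Fin (4 * n),
      (1 + X i j * Y i j + X i j * Z i j + Y i j * Z i j) := by
    refine Finset.dvd_sum fun j _ => ?_
    rcases (hHad X hX).1 i j with a | a <;> rcases (hHad Y hY).1 i j with b | b <;>
      rcases (hHad Z hZ).1 i j with c | c <;> simp [a, b, c]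
  simp only [Finset.sum_add_distrib, Finset.sum_const, Finset.card_univ, Fintype.card_fin,
    nsmul_eq_mul, mul_one] at hd
  push_cast at hd
  omega
end

section
/- There exists a pair of unbiased real Hadamard matrices of order 36. -/
/-- Two real Hadamard matrices are unbiased if every entry of `H * Kᵀ` has
absolute value `√m`, i.e. every entry squares to `m`. -/
def RUnbiased (m : ℕ) (H K : Matrix (Fin m) (Fin m) ℤ) : Prop :=
  ∀ i j, ((H * K.transpose) i j) ^ 2 = (m : ℤ)

/-- Rows of the first matrix, as bit masks (bit `j` set means entry `-1` in column `j`). -/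
def rowsH : List ℕ :=
  [29456105044, 58895662753, 49086758666, 29491196065, 58850013450, 49097994324,
   29502181130, 58884853332, 49052094113, 36698892736, 13268239296, 18886301120,
   18847973895, 36756395015, 13249062919, 13210883128, 18905344056, 36737204792,
   8477886737, 8497959522, 8525522060, 67688089740, 67715502865, 67667829858,
   61138946146, 61091123852, 61111346449, 11391851812, 21726706249, 35819546258,
   21611079460, 35703872585, 11276335762, 35716807460, 11289159241, 21623856274]

/-- Rows of the second matrix. -/
def rowsK : List ℕ :=
  [958710868, 977868961, 1016210186, 7535469217, 7554516234, 7592810580,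
   60148750602, 60167955028, 60206138529, 58789243293, 48991388531, 29395653870,
   58802127598, 49004287389, 29408405875, 58904941939, 49106954478, 29511205789,
   13175615926, 18832945517, 36711428315, 36683878326, 13223300973, 18812735195,
   18860244918, 36663492461, 13195575003, 11382592504, 21706384888, 35764455928,
   21671482311, 35810256327, 11371694535, 35799208511, 11336754239, 21717469247]

/-- The `±1` entry encoded by bit `j` of `a`. -/
def bitSign (a j : ℕ) : ℤ := bif a.testBit j then -1 else 1

/-- The inner product of the first `n` entries of the rows `a` and `b`. -/
def rowDot (a b : ℕ) : ℕ → ℤ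
  | 0 => 0
  | n + 1 => rowDot a b n + bitSign a n * bitSign b n

/-- The matrix encoded by a list of bit masks. -/
def bitMatrix (l : List ℕ) : Matrix (Fin 36) (Fin 36) ℤ :=
  fun i j => bitSign (l.getD i.val 0) j.val

theorem rowDot_eq_sum (a b n : ℕ) :
    rowDot a b n = ∑ j ∈ Finset.range n, bitSign a j * bitSign b j := by
  induction n with
  | zero => rfl
  | succ n ih => rw [Finset.sum_range_succ, ← ih]; rfl

theorem bitMatrix_mul_transpose (l k : List ℕ) (i j : Fin 36) :
    (bitMatrix l * (bitMatrix k).transpose) i j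
      = rowDot (l.getD i.val 0) (k.getD j.val 0) 36 := by
  rw [rowDot_eq_sum, Matrix.mul_apply,
    ← Fin.sum_univ_eq_sum_range
      (fun m => bitSign (l.getD i.val 0) m * bitSign (k.getD j.val 0) m) 36]
  rfl

theorem isHadamard_bitMatrix (l : List ℕ)
    (h : ∀ i < 36, ∀ j < 36, rowDot (l.getD i 0) (l.getD j 0) 36 = if i = j then 36 else 0) :
    IsHadamard 36 (bitMatrix l) := by
  refine ⟨fun i j => ?_, ?_⟩
  · unfold bitMatrix bitSign
    cases (l.getD i.val 0).testBit j.val <;> simp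
  · ext i j
    rw [bitMatrix_mul_transpose, h i.val i.isLt j.val j.isLt, Matrix.smul_apply, Matrix.one_apply]
    by_cases hij : i = j
    · simp [hij]
    · have hv : i.val ≠ j.val := fun hv => hij (Fin.ext hv)
      simp [hij, hv]

theorem rowsH_orthogonal : ∀ i < 36, ∀ j < 36,
    rowDot (rowsH.getD i 0) (rowsH.getD j 0) 36 = if i = j then 36 else 0 := by
  decide +kernel

theorem rowsK_orthogonal : ∀ i < 36, ∀ j < 36,
    rowDot (rowsK.getD i 0) (rowsK.getD j 0) 36 = if i = j then 36 else 0 := by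
  decide +kernel

theorem rows_unbiased : ∀ i < 36, ∀ j < 36,
    rowDot (rowsH.getD i 0) (rowsK.getD j 0) 36 ^ 2 = 36 := by
  decide +kernel

theorem exists_unbiased_hadamard_pair_order_36 :
    ∃ H K : Matrix (Fin 36) (Fin 36) ℤ,
      IsHadamard 36 H ∧ IsHadamard 36 K ∧ RUnbiased 36 H K := by
  refine ⟨bitMatrix rowsH, bitMatrix rowsK, isHadamard_bitMatrix _ rowsH_orthogonal,
    isHadamard_bitMatrix _ rowsK_orthogonal, fun i j => ?_⟩
  rw [bitMatrix_mul_transpose, rows_unbiased i.val i.isLt j.val j.isLt]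
  rfl
end
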